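/- Let I ⊆ R be a proper homogeneous ideal of height at least 2 which is numerically ACM, and let J = G·I + (F) be a basic double link of I of type (d,a). Then J is also numerically ACM. -/

import Mathlib

open MvPolynomial

noncomputable section

/-- The polynomial ring `K[x_0, ..., x_n]`. -/
abbrev PR (K : Type) [Field K] (n : ℕ) := MvPolynomial (Fin (n + 1)) K

/-- An ideal is homogeneous if it contains all homogeneous components of its elements. -/
def IsHomogIdeal {K : Type} [Field K] {n : ℕ} (I : Ideal (PR K n)) : Prop :=
  ∀ F ∈ I, ∀ d : ℕ, homogeneousComponent d F ∈ I

/-- `F, G` is a regular sequence in `R`: `F` is a nonzerodivisor on `R` and `G` is a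
nonzerodivisor on `R/(F)`. -/
def IsRegSeq {K : Type} [Field K] {n : ℕ} (F G : PR K n) : Prop :=
  IsSMulRegular (PR K n) F ∧
    IsSMulRegular ((PR K n) ⧸ Ideal.span {F}) (Ideal.Quotient.mk (Ideal.span {F}) G)

/-- The height of an ideal: the infimum of the heights of the primes containing it. -/
def idealHeight {A : Type} [CommRing A] (I : Ideal A) : ℕ∞ :=
  ⨅ (P : PrimeSpectrum A) (_ : I ≤ P.asIdeal), Order.height P

/-- The Hilbert function of `R/I`: `h_{R/I}(t) = dim_K R_t - dim_K (I ∩ R_t)`. -/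
def hilbQuot {K : Type} [Field K] {n : ℕ} (I : Ideal (PR K n)) (t : ℤ) : ℤ :=
  if t < 0 then 0 else
    (Module.finrank K (homogeneousSubmodule (Fin (n + 1)) K t.toNat) : ℤ) -
      (Module.finrank K
        ((Submodule.restrictScalars K I) ⊓ homogeneousSubmodule (Fin (n + 1)) K t.toNat :
          Submodule K (PR K n)) : ℤ)

/-- The Hilbert function of the polynomial ring in `n+1` variables. -/
def hPoly (n : ℕ) (k : ℤ) : ℤ := if k < 0 then 0 else (Nat.choose (n + k.toNat) n : ℤ)

/-- The ideal `J` has a free resolution `0 → A^p → A^q → J → 0`. -/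
def HasLen1FreeRes {A : Type} [CommRing A] (J : Ideal A) : Prop :=
  ∃ (p q : ℕ) (f : (Fin p → A) →ₗ[A] (Fin q → A)) (g : (Fin q → A) →ₗ[A] A),
    Function.Injective f ∧ LinearMap.ker g = LinearMap.range f ∧ LinearMap.range g = J

/-- `J` is numerically ACM: some proper homogeneous ideal `J'` of height 2 with `R/J'`
Cohen-Macaulay (equivalently, of projective dimension 2) has the same Hilbert function. -/
def NumACM {K : Type} [Field K] {n : ℕ} (J : Ideal (PR K n)) : Prop :=
  ∃ J' : Ideal (PR K n), J' ≠ ⊤ ∧ IsHomogIdeal J' ∧ idealHeight J' = 2 ∧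
    HasLen1FreeRes J' ∧ ∀ t : ℤ, hilbQuot J' t = hilbQuot J t

/-- `J` is a basic double link of `I` of type `(d, a)`. -/
def IsBDL {K : Type} [Field K] {n : ℕ} (I J : Ideal (PR K n)) (d a : ℕ) : Prop :=
  ∃ F G : PR K n, F ∈ I ∧ F ≠ 0 ∧ F.IsHomogeneous d ∧ 1 ≤ a ∧ G.IsHomogeneous a ∧
    IsRegSeq F G ∧ J = Ideal.span {G} * I + Ideal.span {F}

/-- The first map `R → R ⊕ I`, `x ↦ (G·x, -F·x)`. -/
def bdlα {K : Type} [Field K] {n : ℕ} (I : Ideal (PR K n)) (F G : PR K n) (hF : F ∈ I) :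
    PR K n →ₗ[PR K n] (PR K n) × I :=
  (LinearMap.mulLeft (PR K n) G).prod
    (LinearMap.codRestrict I (LinearMap.mulLeft (PR K n) (-F))
      (fun x => I.mul_mem_right x (I.neg_mem hF)))

/-- The second map `R ⊕ I → R`, `(p, q) ↦ p·F + q·G`. -/
def bdlβ {K : Type} [Field K] {n : ℕ} (I : Ideal (PR K n)) (F G : PR K n) :
    (PR K n) × I →ₗ[PR K n] PR K n :=
  (LinearMap.mulLeft (PR K n) F).comp (LinearMap.fst _ _ _) +
    (LinearMap.mulLeft (PR K n) G).comp (I.subtype.comp (LinearMap.snd _ _ _))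
/-- The finite difference operator `(Δf)(k) = f(k) - f(k-1)`. -/
def deltaOp (f : ℤ → ℤ) : ℤ → ℤ := fun k => f k - f (k - 1)

/-- The number of minimal generators of `I` in degree `d`, i.e. the `K`-dimension of the
degree-`d` component of `I/𝔪I`, computed as `dim_K (I ∩ R_d) - dim_K (𝔪I ∩ R_d)`. -/
def minGensDeg {K : Type} [Field K] {n : ℕ} (I : Ideal (PR K n)) (d : ℕ) : ℤ :=
  (Module.finrank K
      ((Submodule.restrictScalars K I) ⊓ homogeneousSubmodule (Fin (n + 1)) K d :
        Submodule K (PR K n)) : ℤ) -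
    (Module.finrank K
      ((Submodule.restrictScalars K
          (Ideal.span (Set.range (X : Fin (n + 1) → PR K n)) * I)) ⊓
          homogeneousSubmodule (Fin (n + 1)) K d :
        Submodule K (PR K n)) : ℤ)

/-- The ideal `I` is saturated with respect to `𝔪 = (x_0, ..., x_n)`. -/
def IsSatIdeal {K : Type} [Field K] {n : ℕ} (I : Ideal (PR K n)) : Prop :=
  ∀ x : PR K n,
    (∃ k : ℕ, ∀ y ∈ (Ideal.span (Set.range (X : Fin (n + 1) → PR K n))) ^ k, x * y ∈ I) →
      x ∈ I

section HomogeneousComponents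

attribute [local instance] MvPolynomial.gradedAlgebra

variable {K : Type} [Field K] {n : ℕ}

lemma coe_decompose_eq_homogeneousComponent (x : PR K n) (t : ℕ) :
    (DirectSum.decompose (homogeneousSubmodule (Fin (n + 1)) K) x t : PR K n) =
      homogeneousComponent t x :=
  decomposition.decompose'_apply x t

lemma isHomogIdeal_iff {I : Ideal (PR K n)} :
    IsHomogIdeal I ↔ I.IsHomogeneous (homogeneousSubmodule (Fin (n + 1)) K) := by
  constructor
  · intro h t x hx
    rw [coe_decompose_eq_homogeneousComponent]
    exact h x hx t
  · intro h x hx t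
    exact homogeneousComponent_mem_of_mem h hx t

lemma homogeneousComponent_mul_of_le {G : PR K n} {a t : ℕ} (hG : G.IsHomogeneous a)
    (h : a ≤ t) (x : PR K n) :
    homogeneousComponent t (G * x) = G * homogeneousComponent (t - a) x := by
  simp only [← coe_decompose_eq_homogeneousComponent]
  exact DirectSum.coe_decompose_mul_of_left_mem_of_le _ hG h

lemma homogeneousComponent_mul_of_not_le {G : PR K n} {a t : ℕ} (hG : G.IsHomogeneous a)
    (h : ¬ a ≤ t) (x : PR K n) :
    homogeneousComponent t (G * x) = 0 := by
  simp only [← coe_decompose_eq_homogeneousComponent]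
  exact DirectSum.coe_decompose_mul_of_left_mem_of_not_le _ hG h

lemma isHomogIdeal_span_singleton {G : PR K n} {a : ℕ} (hG : G.IsHomogeneous a) :
    IsHomogIdeal (Ideal.span {G}) := by
  rw [isHomogIdeal_iff]
  refine Ideal.homogeneous_span _ _ fun x hx => ?_
  obtain rfl := Set.mem_singleton_iff.mp hx
  exact ⟨a, hG⟩

lemma IsHomogIdeal.mul {I J : Ideal (PR K n)} (hI : IsHomogIdeal I) (hJ : IsHomogIdeal J) :
    IsHomogIdeal (I * J) :=
  isHomogIdeal_iff.mpr ((isHomogIdeal_iff.mp hI).mul (isHomogIdeal_iff.mp hJ))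

lemma IsHomogIdeal.add {I J : Ideal (PR K n)} (hI : IsHomogIdeal I) (hJ : IsHomogIdeal J) :
    IsHomogIdeal (I + J) :=
  isHomogIdeal_iff.mpr ((isHomogIdeal_iff.mp hI).sup (isHomogIdeal_iff.mp hJ))

end HomogeneousComponents

section GradedPieces

variable {K : Type} [Field K] {n : ℕ}

/-- The degree-`t` piece `I ∩ R_t` of an ideal. -/
def gradedPiece (I : Ideal (PR K n)) (t : ℕ) : Submodule K (PR K n) :=
  Submodule.restrictScalars K I ⊓ homogeneousSubmodule (Fin (n + 1)) K t

lemma mem_gradedPiece {I : Ideal (PR K n)} {t : ℕ} {x : PR K n} :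
    x ∈ gradedPiece I t ↔ x ∈ I ∧ x.IsHomogeneous t :=
  Iff.rfl

instance finiteDimensional_homogeneousSubmodule (t : ℕ) :
    FiniteDimensional K (homogeneousSubmodule (Fin (n + 1)) K t) :=
  Module.Finite.iff_fg.mpr (homogeneousSubmodule_fg (Fin (n + 1)) K t)

instance finiteDimensional_gradedPiece (I : Ideal (PR K n)) (t : ℕ) :
    FiniteDimensional K (gradedPiece I t) :=
  Submodule.finiteDimensional_of_le (inf_le_right :
    gradedPiece I t ≤ homogeneousSubmodule (Fin (n + 1)) K t)

lemma hilbQuot_natCast (I : Ideal (PR K n)) (t : ℕ) :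
    hilbQuot I t = (Module.finrank K (homogeneousSubmodule (Fin (n + 1)) K t) : ℤ) -
      (Module.finrank K (gradedPiece I t) : ℤ) :=
  if_neg (Int.natCast_nonneg t).not_gt

lemma hilbQuot_eq_iff {I J : Ideal (PR K n)} :
    (∀ t : ℤ, hilbQuot I t = hilbQuot J t) ↔
      ∀ t : ℕ, Module.finrank K (gradedPiece I t) = Module.finrank K (gradedPiece J t) := by
  constructor
  · intro h t
    have := h t
    rw [hilbQuot_natCast, hilbQuot_natCast] at this
    exact Int.natCast_inj.mp (sub_right_injective this)
  · intro h t
    rcases lt_or_ge t 0 with ht | ht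
    · rw [hilbQuot, hilbQuot, if_pos ht, if_pos ht]
    · lift t to ℕ using ht
      rw [hilbQuot_natCast, hilbQuot_natCast, h]

lemma gradedPiece_add {I J : Ideal (PR K n)} (hI : IsHomogIdeal I) (hJ : IsHomogIdeal J)
    (t : ℕ) : gradedPiece (I + J) t = gradedPiece I t ⊔ gradedPiece J t := by
  ext x
  rw [Submodule.mem_sup]
  constructor
  · rintro ⟨hx, hxt⟩
    obtain ⟨y, hy, z, hz, rfl⟩ := Submodule.mem_sup.mp hx
    refine ⟨homogeneousComponent t y, ⟨hI y hy t, homogeneousComponent_mem t y⟩,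
      homogeneousComponent t z, ⟨hJ z hz t, homogeneousComponent_mem t z⟩, ?_⟩
    rw [← map_add, homogeneousComponent_eq_self hxt]
  · rintro ⟨y, ⟨hy, hyt⟩, z, ⟨hz, hzt⟩, rfl⟩
    exact ⟨Submodule.add_mem_sup hy hz, Submodule.add_mem _ hyt hzt⟩

lemma gradedPiece_inf (I J : Ideal (PR K n)) (t : ℕ) :
    gradedPiece (I ⊓ J) t = gradedPiece I t ⊓ gradedPiece J t := by
  ext x
  simp only [Submodule.mem_inf, mem_gradedPiece]
  tauto

/-- The dimension of the degree-`t` piece of `G · I` for a nonzero form `G`. -/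
lemma finrank_gradedPiece_span_mul (I : Ideal (PR K n)) {G : PR K n} {a : ℕ}
    (hG : G.IsHomogeneous a) (hG0 : G ≠ 0) (t : ℕ) :
    Module.finrank K (gradedPiece (Ideal.span {G} * I) t) =
      if a ≤ t then Module.finrank K (gradedPiece I (t - a)) else 0 := by
  split_ifs with h
  · have hmap : gradedPiece (Ideal.span {G} * I) t =
        (gradedPiece I (t - a)).map (LinearMap.mulLeft K G) := by
      ext x
      simp only [Submodule.mem_map, mem_gradedPiece, LinearMap.mulLeft_apply]
      constructor
      · rintro ⟨hx, hxt⟩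
        obtain ⟨y, hy, rfl⟩ := Ideal.mem_span_singleton_mul.mp hx
        have hc := homogeneousComponent_mul_of_le hG h y
        rw [homogeneousComponent_eq_self hxt] at hc
        refine ⟨y, ⟨hy, ?_⟩, rfl⟩
        rw [mul_left_cancel₀ hG0 hc]
        exact homogeneousComponent_isHomogeneous _ _
      · rintro ⟨y, ⟨hy, hyt⟩, rfl⟩
        refine ⟨Ideal.mem_span_singleton_mul.mpr ⟨y, hy, rfl⟩, ?_⟩
        have := hG.mul hyt
        rwa [Nat.add_sub_cancel' h] at this
    rw [hmap]
    exact (Submodule.equivMapOfInjective _ (mul_right_injective₀ hG0) _).finrank_eq.symm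
  · have hbot : gradedPiece (Ideal.span {G} * I) t = ⊥ := by
      refine (Submodule.eq_bot_iff _).mpr ?_
      rintro x ⟨hx, hxt⟩
      obtain ⟨y, hy, rfl⟩ := Ideal.mem_span_singleton_mul.mp hx
      rw [← homogeneousComponent_eq_self hxt, homogeneousComponent_mul_of_not_le hG h]
    rw [hbot, finrank_bot]

lemma span_mul_inf_span {A : Type} [CommRing A] {I : Ideal A} {F G : A}
    (hF : F ∈ I) (hcop : ∀ x, G ∣ F * x → G ∣ x) :
    Ideal.span {G} * I ⊓ Ideal.span {F} = Ideal.span {G * F} * ⊤ := by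
  ext x
  rw [Ideal.mul_top, Ideal.mem_span_singleton, Submodule.mem_inf, Ideal.mem_span_singleton]
  constructor
  · rintro ⟨hx, z, rfl⟩
    obtain ⟨y, hy, hyz⟩ := Ideal.mem_span_singleton_mul.mp hx
    obtain ⟨u, rfl⟩ := hcop z ⟨y, hyz.symm⟩
    exact ⟨u, by ring⟩
  · rintro ⟨u, rfl⟩
    refine ⟨?_, ⟨G * u, by ring⟩⟩
    exact Ideal.mem_span_singleton_mul.mpr ⟨F * u, I.mul_mem_right u hF, by ring⟩

/-- The Hilbert function of a basic double link. -/
lemma finrank_gradedPiece_bdl {I : Ideal (PR K n)} (hI : IsHomogIdeal I) {F G : PR K n}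
    {d a : ℕ} (hF : F ∈ I) (hF0 : F ≠ 0) (hFd : F.IsHomogeneous d) (hG0 : G ≠ 0)
    (hGa : G.IsHomogeneous a) (hcop : ∀ x, G ∣ F * x → G ∣ x) (t : ℕ) :
    Module.finrank K (gradedPiece (Ideal.span {G} * I + Ideal.span {F}) t) +
        (if a + d ≤ t then
          Module.finrank K (gradedPiece (⊤ : Ideal (PR K n)) (t - (a + d))) else 0) =
      (if a ≤ t then Module.finrank K (gradedPiece I (t - a)) else 0) +
        (if d ≤ t then Module.finrank K (gradedPiece (⊤ : Ideal (PR K n)) (t - d)) else 0) := by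
  rw [← finrank_gradedPiece_span_mul I hGa hG0, ← finrank_gradedPiece_span_mul ⊤ hFd hF0,
    ← finrank_gradedPiece_span_mul ⊤ (hGa.mul hFd) (mul_ne_zero hG0 hF0),
    ← span_mul_inf_span hF hcop, gradedPiece_inf, Ideal.mul_top,
    gradedPiece_add ((isHomogIdeal_span_singleton hGa).mul hI) (isHomogIdeal_span_singleton hFd)]
  exact Submodule.finrank_sup_add_finrank_inf_eq _ _

end GradedPieces

section Resolution

/-- A resolution of `I` of length one induces one of the basic double link `G · I + (F)`. -/
lemma HasLen1FreeRes.bdl {A : Type} [CommRing A] [IsDomain A] {I : Ideal A}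
    (hI : HasLen1FreeRes I) {F G : A} (hF : F ∈ I) (hG0 : G ≠ 0)
    (hcop : ∀ x, G ∣ F * x → G ∣ x) :
    HasLen1FreeRes (Ideal.span {G} * I + Ideal.span {F}) := by
  obtain ⟨p, q, f, g, hf, hker, hran⟩ := hI
  obtain ⟨s, hs⟩ : ∃ s, g s = F := by rwa [← LinearMap.mem_range, hran]
  have hgf (v) : g (f v) = 0 := by
    rw [← LinearMap.mem_ker, hker]
    exact LinearMap.mem_range_self f v
  let f₀ : (A × (Fin p → A)) →ₗ[A] (A × (Fin q → A)) :=
    (G • LinearMap.fst A A (Fin p → A)).prod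
      (f ∘ₗ LinearMap.snd A A (Fin p → A) -
        (LinearMap.fst A A (Fin p → A)).smulRight s)
  let g₀ : (A × (Fin q → A)) →ₗ[A] A :=
    F • LinearMap.fst A A (Fin q → A) + G • (g ∘ₗ LinearMap.snd A A (Fin q → A))
  have hf₀ (u v) : f₀ (u, v) = (G * u, f v - u • s) := by simp [f₀]
  have hg₀ (x y) : g₀ (x, y) = F * x + G * g y := by simp [g₀]
  have hinj : Function.Injective f₀ := by
    rw [injective_iff_map_eq_zero]
    rintro ⟨u, v⟩ h
    rw [hf₀, Prod.mk_eq_zero] at h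
    obtain ⟨h₁, h₂⟩ := h
    obtain rfl : u = 0 := (mul_eq_zero.mp h₁).resolve_left hG0
    rw [zero_smul, sub_zero, map_eq_zero_iff f hf] at h₂
    rw [h₂, Prod.mk_zero_zero]
  have hexact : LinearMap.ker g₀ = LinearMap.range f₀ := by
    ext ⟨x, y⟩
    rw [LinearMap.mem_ker, LinearMap.mem_range, hg₀]
    constructor
    · intro h
      obtain ⟨u, rfl⟩ := hcop x ⟨-g y, by linear_combination h⟩
      have hy : g (y + u • s) = 0 := by
        apply mul_left_cancel₀ hG0
        rw [map_add, map_smul, hs, smul_eq_mul]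
        linear_combination h
      rw [← LinearMap.mem_ker, hker] at hy
      obtain ⟨v, hv⟩ := hy
      exact ⟨(u, v), by rw [hf₀, hv, add_sub_cancel_right]⟩
    · rintro ⟨⟨u, v⟩, h⟩
      rw [hf₀, Prod.mk_inj] at h
      rw [← h.1, ← h.2, map_sub, hgf, map_smul, hs, smul_eq_mul]
      ring
  have hrange : LinearMap.range g₀ = Ideal.span {G} * I + Ideal.span {F} := by
    ext z
    rw [LinearMap.mem_range, Submodule.add_eq_sup, Submodule.mem_sup]
    constructor
    · rintro ⟨⟨x, y⟩, rfl⟩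
      refine ⟨G * g y, Ideal.mem_span_singleton_mul.mpr ⟨g y, ?_, rfl⟩, F * x,
        Ideal.mem_span_singleton.mpr ⟨x, rfl⟩, ?_⟩
      · rw [← hran]
        exact LinearMap.mem_range_self g y
      · rw [hg₀, add_comm]
    · rintro ⟨z₁, h₁, z₂, h₂, rfl⟩
      obtain ⟨w, hw, rfl⟩ := Ideal.mem_span_singleton_mul.mp h₁
      obtain ⟨x, rfl⟩ := Ideal.mem_span_singleton.mp h₂
      rw [← hran] at hw
      obtain ⟨y, rfl⟩ := hw
      exact ⟨(x, y), by rw [hg₀, add_comm]⟩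
  let ep := Fin.consLinearEquiv A (fun _ : Fin (p + 1) => A)
  let eq := Fin.consLinearEquiv A (fun _ : Fin (q + 1) => A)
  refine ⟨p + 1, q + 1, eq.toLinearMap ∘ₗ f₀ ∘ₗ ep.symm.toLinearMap,
    g₀ ∘ₗ eq.symm.toLinearMap, ?_, ?_, ?_⟩
  · exact eq.injective.comp (hinj.comp ep.symm.injective)
  · rw [LinearMap.ker_comp, hexact, LinearMap.range_comp,
      LinearMap.range_comp_of_range_eq_top _ ep.symm.range]
    exact (Submodule.map_equiv_eq_comap_symm eq _).symm
  · rw [LinearMap.range_comp_of_range_eq_top _ eq.symm.range, hrange]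

end Resolution

section Height

lemma idealHeight_anti {A : Type} [CommRing A] {I J : Ideal A} (h : I ≤ J) :
    idealHeight I ≤ idealHeight J :=
  le_iInf₂ fun P hP => iInf₂_le P (h.trans hP)

lemma two_le_height_of_prime_mem {A : Type} [CommRing A] [IsDomain A] {P : PrimeSpectrum A}
    {l F : A} (hl : Prime l) (hlP : l ∈ P.asIdeal) (hFP : F ∈ P.asIdeal) (hlF : ¬ l ∣ F) :
    2 ≤ Order.height P := by
  let L : PrimeSpectrum A :=
    ⟨Ideal.span {l}, (Ideal.span_singleton_prime hl.ne_zero).mpr hl⟩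
  let Z : PrimeSpectrum A := ⟨⊥, Ideal.isPrime_bot⟩
  have hZL : Z < L := by
    rw [← PrimeSpectrum.asIdeal_lt_asIdeal]
    exact bot_lt_iff_ne_bot.mpr fun h => hl.ne_zero (Ideal.span_singleton_eq_bot.mp h)
  have hLP : L < P := by
    rw [← PrimeSpectrum.asIdeal_lt_asIdeal]
    refine lt_of_le_of_ne ((Ideal.span_singleton_le_iff_mem _).mpr hlP) fun h => hlF ?_
    rw [← Ideal.mem_span_singleton]
    exact h.ge hFP
  calc (2 : ℕ∞) = 0 + 1 + 1 := by norm_num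
    _ ≤ Order.height Z + 1 + 1 := by gcongr; exact zero_le
    _ ≤ Order.height L + 1 := by gcongr; exact Order.height_add_one_le hZL
    _ ≤ Order.height P := Order.height_add_one_le hLP

lemma two_le_idealHeight_bdl {A : Type} [CommRing A] [IsDomain A] {I : Ideal A}
    (hI : 2 ≤ idealHeight I) {F l : A} (hl : Prime l) (hlF : ¬ l ∣ F) (a : ℕ) :
    2 ≤ idealHeight (Ideal.span {l ^ a} * I + Ideal.span {F}) := by
  refine le_iInf₂ fun P hP => ?_
  obtain ⟨h₁, h₂⟩ := sup_le_iff.mp hP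
  rcases P.isPrime.mul_le.mp h₁ with h | h
  · exact two_le_height_of_prime_mem hl
      (P.isPrime.mem_of_pow_mem a ((Ideal.span_singleton_le_iff_mem _).mp h))
      ((Ideal.span_singleton_le_iff_mem _).mp h₂) hlF
  · exact hI.trans (iInf₂_le P h)

end Height

section LinearForms

variable {K : Type} [Field K] {n : ℕ}

lemma prime_of_isHomogeneous_one {l : PR K n} (hl : l.IsHomogeneous 1) (hl0 : l ≠ 0) :
    Prime l := by
  refine (irreducible_of_totalDegree_eq_one (hl.totalDegree hl0) fun x hx => ?_).prime
  obtain ⟨i, hi⟩ := ne_zero_iff.mp hl0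
  rw [isUnit_iff_ne_zero]
  rintro rfl
  exact hi (zero_dvd_iff.mp (hx i))

/-- Over an infinite field, some nonzero linear form does not divide a given nonzero form. -/
lemma exists_linearForm_not_dvd [Infinite K] (hn : 1 ≤ n) {F : PR K n} (hF : F ≠ 0) :
    ∃ l : PR K n, l.IsHomogeneous 1 ∧ l ≠ 0 ∧ ¬ l ∣ F := by
  have h01 : (0 : Fin (n + 1)) ≠ Fin.last n := by
    intro h
    have := congrArg Fin.val h
    simp at this
    lia
  obtain ⟨p, hp⟩ : ∃ p, eval p (F * X 0) ≠ 0 := by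
    by_contra! h
    exact mul_ne_zero hF (X_ne_zero 0) (funext fun p => by rw [h p, map_zero])
  rw [map_mul, eval_X] at hp
  refine ⟨C (p (Fin.last n)) * X 0 - C (p 0) * X (Fin.last n), ?_, ?_, ?_⟩
  · exact (isHomogeneous_C_mul_X _ _).sub (isHomogeneous_C_mul_X _ _)
  · intro h
    have := congrArg (eval (Pi.single (Fin.last n) 1)) h
    simp [h01] at this
    exact right_ne_zero_of_mul hp this
  · rintro ⟨y, rfl⟩
    apply hp
    simp [mul_comm]

end LinearForms

lemma IsRegSeq.dvd_of_dvd_mul {K : Type} [Field K] {n : ℕ} {F G : PR K n} (h : IsRegSeq F G)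
    {x : PR K n} (hx : G ∣ F * x) : G ∣ x := by
  obtain ⟨y, hy⟩ := hx
  have hyF : F ∣ y := by
    rw [← Ideal.mem_span_singleton, ← Ideal.Quotient.eq_zero_iff_mem]
    apply h.2
    simp only [smul_eq_mul, mul_zero]
    rw [← map_mul, Ideal.Quotient.eq_zero_iff_mem, Ideal.mem_span_singleton, ← hy]
    exact dvd_mul_right F x
  obtain ⟨u, rfl⟩ := hyF
  refine ⟨u, h.1 ?_⟩
  simp only [smul_eq_mul]
  linear_combination hy

lemma IsRegSeq.right_ne_zero {K : Type} [Field K] {n : ℕ} {F G : PR K n} (h : IsRegSeq F G)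
    (hF : ¬ IsUnit F) : G ≠ 0 := by
  rintro rfl
  refine hF (isUnit_of_dvd_one ?_)
  rw [← Ideal.mem_span_singleton, ← Ideal.Quotient.eq_zero_iff_mem]
  apply h.2
  simp

theorem stmt14 {K : Type} [Field K] [Infinite K] {n : ℕ} (hn : 2 ≤ n)
    (I : Ideal (PR K n)) (hI : IsHomogIdeal I) (hIp : I ≠ ⊤) (hht : 2 ≤ idealHeight I)
    (hnacm : NumACM I)
    (J : Ideal (PR K n)) (d a : ℕ) (hJ : IsBDL I J d a) :
    NumACM J := by
  obtain ⟨F, G, hFI, hF0, hFd, -, hGa, hreg, rfl⟩ := hJ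
  obtain ⟨I', hI'p, hI', hI'h, hres, hhilb⟩ := hnacm
  rw [hilbQuot_eq_iff] at hhilb
  have hG0 : G ≠ 0 := hreg.right_ne_zero fun h => hIp (Ideal.eq_top_of_isUnit_mem I hFI h)
  have hne : gradedPiece I' d ≠ ⊥ := by
    intro h
    have h0 := hhilb d
    rw [h, finrank_bot, eq_comm, Submodule.finrank_eq_zero] at h0
    exact hF0 ((Submodule.eq_bot_iff _).mp h0 F ⟨hFI, hFd⟩)
  obtain ⟨F', ⟨hF'I, hF'd⟩, hF'0⟩ := Submodule.exists_mem_ne_zero_of_ne_bot hne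
  obtain ⟨l, hl1, hl0, hlF⟩ := exists_linearForm_not_dvd (by lia) hF'0
  have hl : Prime l := prime_of_isHomogeneous_one hl1 hl0
  have hla : (l ^ a).IsHomogeneous a := by simpa using hl1.pow a
  have hcop (x) (hx : l ^ a ∣ F' * x) : l ^ a ∣ x := hl.pow_dvd_of_dvd_mul_left a hlF hx
  have hle : Ideal.span {l ^ a} * I' + Ideal.span {F'} ≤ I' :=
    sup_le Ideal.mul_le_right ((Ideal.span_singleton_le_iff_mem _).mpr hF'I)
  refine ⟨Ideal.span {l ^ a} * I' + Ideal.span {F'}, ne_top_of_le_ne_top hI'p hle,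
    ((isHomogIdeal_span_singleton hla).mul hI').add (isHomogIdeal_span_singleton hF'd),
    le_antisymm (hI'h ▸ idealHeight_anti hle) (two_le_idealHeight_bdl hI'h.ge hl hlF a),
    hres.bdl hF'I (pow_ne_zero a hl0) hcop, hilbQuot_eq_iff.mpr fun t => ?_⟩
  have h₁ := finrank_gradedPiece_bdl hI' hF'I hF'0 hF'd (pow_ne_zero a hl0) hla hcop t
  have h₂ := finrank_gradedPiece_bdl hI hFI hF0 hFd hG0 hGa (fun x => hreg.dvd_of_dvd_mul) t
  rw [hhilb] at h₁
  lia
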